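/- Let I₀ : ℝ → ℝ be a function that is continuous and strictly positive on [0, ∞) and satisfies I₀(r)·√(2πr)·e^{−r} → 1 as r → ∞. Then for any 0 < γ₁ < γ₂ there exists a constant A(γ₁, γ₂) > 0 such that for all real numbers a, b with 0 < b < a, one has e^{−γ₂(a−b)} ≤ A(γ₁, γ₂) · I₀(γ₁·b) / I₀(γ₁·a). -/

import Mathlib

open Real Filter

theorem stmt5 (I₀ : ℝ → ℝ)
    (hcont : ContinuousOn I₀ (Set.Ici 0))
    (hpos : ∀ r ∈ Set.Ici (0 : ℝ), 0 < I₀ r)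
    (hasymp : Tendsto (fun r => I₀ r * Real.sqrt (2 * Real.pi * r) * Real.exp (-r))
      atTop (nhds 1)) :
    ∀ γ₁ γ₂ : ℝ, 0 < γ₁ → γ₁ < γ₂ →
      ∃ A : ℝ, 0 < A ∧ ∀ a b : ℝ, 0 < b → b < a →
        Real.exp (-γ₂ * (a - b)) ≤ A * I₀ (γ₁ * b) / I₀ (γ₁ * a) := by
  intro γ₁ γ₂ h1 h12
  obtain ⟨g, hg⟩ : ∃ g : ℝ → ℝ, ∀ r, g r = I₀ r * Real.exp (-r) := ⟨_, fun _ => rfl⟩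
  have hgpos : ∀ r, 0 ≤ r → 0 < g r := fun r hr => by
    rw [hg]; exact mul_pos (hpos r hr) (Real.exp_pos _)
  have hgc : ContinuousOn g (Set.Ici 0) := by
    have : g = fun r => I₀ r * Real.exp (-r) := funext hg
    rw [this]
    exact hcont.mul (by fun_prop)
  have hev := (hasymp.eventually (Ioo_mem_nhds (show (1/2:ℝ) < 1 by norm_num)
    (show (1:ℝ) < 2 by norm_num)))
  obtain ⟨R, hR⟩ := (hev.and (eventually_ge_atTop 1)).exists_forall_of_atTop
  have hR1 : 1 ≤ R := (hR R le_rfl).2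
  have hlo : ∀ r, R ≤ r → 1/2 < g r * Real.sqrt (2 * Real.pi * r) := fun r hr => by
    have := (hR r hr).1.1
    rw [hg]; linarith
  have hhi : ∀ r, R ≤ r → g r * Real.sqrt (2 * Real.pi * r) < 2 := fun r hr => by
    have := (hR r hr).1.2
    rw [hg]; linarith
  have hne : (Set.Icc (0:ℝ) R).Nonempty := ⟨0, le_rfl, by linarith⟩
  have hgc' : ContinuousOn g (Set.Icc 0 R) := hgc.mono Set.Icc_subset_Ici_self
  obtain ⟨p, hp, hpm⟩ := isCompact_Icc.exists_isMinOn hne hgc'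
  obtain ⟨q, hq, hqM⟩ := isCompact_Icc.exists_isMaxOn hne hgc'
  have hm := hgpos p hp.1
  have hM := hgpos q hq.1
  have hs1 : ∀ r, R ≤ r → 1 ≤ Real.sqrt (2 * Real.pi * r) := fun r hr => by
    rw [Real.one_le_sqrt]
    nlinarith [Real.pi_gt_three]
  have key : ∀ x y, 0 < y → y < x → g x ≤ (g q / g p + 4 + 2 / g p) * g y := by
    intro x y hy hyx
    have hgy := hgpos y hy.le
    have hgx := hgpos x (hy.trans hyx).le
    have e1 : 0 < g q / g p * g y := by positivity
    have e2 : 0 < 2 / g p * g y := by positivity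
    rw [add_mul, add_mul]
    rcases le_or_gt R y with h | h
    · have a1 := hlo y h
      have a2 := hhi x (h.trans hyx.le)
      have a3 : Real.sqrt (2 * Real.pi * y) ≤ Real.sqrt (2 * Real.pi * x) := by
        gcongr
      have a4 := hs1 y h
      have a5 : g x ≤ 4 * g y := by
        by_contra hc
        push Not at hc
        nlinarith [mul_le_mul_of_nonneg_left a3 hgx.le]
      linarith
    · have hpy : g p ≤ g y := hpm ⟨hy.le, h.le⟩
      rcases le_or_gt x R with h' | h'
      · have hxq : g x ≤ g q := hqM ⟨(hy.trans hyx).le, h'⟩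
        have : g q ≤ g q / g p * g y := by
          rw [div_mul_eq_mul_div, le_div_iff₀ hm]
          gcongr
        linarith
      · have a2 := hhi x h'.le
        have a4 := hs1 x h'.le
        have : 2 ≤ 2 / g p * g y := by
          rw [div_mul_eq_mul_div, le_div_iff₀ hm]
          gcongr
        nlinarith
  refine ⟨g q / g p + 4 + 2 / g p, by positivity, fun a b hb hab => ?_⟩
  have hx : 0 < γ₁ * a := mul_pos h1 (hb.trans hab)
  have k := key (γ₁ * a) (γ₁ * b) (mul_pos h1 hb) (by gcongr)
  have hIx := hpos _ hx.le
  rw [le_div_iff₀ hIx]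
  generalize g q / g p + 4 + 2 / g p = A at k
  rw [hg, hg] at k
  have k2 : I₀ (γ₁ * a) * Real.exp (-(γ₁ * a)) * Real.exp (γ₁ * b) ≤ A * I₀ (γ₁ * b) := by
    calc _ ≤ A * (I₀ (γ₁ * b) * Real.exp (-(γ₁ * b))) * Real.exp (γ₁ * b) := by gcongr
      _ = A * I₀ (γ₁ * b) * (Real.exp (-(γ₁ * b)) * Real.exp (γ₁ * b)) := by ring
      _ = _ := by rw [← Real.exp_add]; simp
  refine le_trans ?_ k2
  rw [mul_assoc, ← Real.exp_add, mul_comm]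
  gcongr
  nlinarith
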